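/- Fix a, b ∈ ℂ with a ≠ 0, b ≠ 0, a ≠ b, and set v₁ = v₂ = (1,0,0), v₃ = (0,1,0), v₄ = (0,0,1), v₅ = (0,1,a), v₆ = (0,1,b) in ℂ³. Then for a matrix g ∈ SL₃(ℂ), one has: (for every i = 1,…,6 there exists a nonzero scalar cᵢ ∈ ℂ with g·vᵢ = cᵢ vᵢ) if and only if there exists λ ∈ ℂ* such that g is the diagonal matrix diag(λ⁻², λ, λ). -/

import Mathlib

theorem stmt_17 (a b : ℂ) (ha : a ≠ 0) (hb : b ≠ 0) (hab : a ≠ b)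
    (v : Fin 6 → Fin 3 → ℂ)
    (hv : v = ![![1, 0, 0], ![1, 0, 0], ![0, 1, 0], ![0, 0, 1], ![0, 1, a], ![0, 1, b]])
    (g : Matrix.SpecialLinearGroup (Fin 3) ℂ) :
    (∀ i : Fin 6, ∃ c : ℂ, c ≠ 0 ∧
        (g : Matrix (Fin 3) (Fin 3) ℂ).mulVec (v i) = c • v i) ↔
      ∃ l : ℂ, l ≠ 0 ∧
        (g : Matrix (Fin 3) (Fin 3) ℂ) = Matrix.diagonal ![(l ^ 2)⁻¹, l, l] := by
  subst hv
  obtain ⟨M, hdet⟩ := g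
  simp only
  constructor
  · intro h
    obtain ⟨c₁, -, h₁⟩ := h 0
    obtain ⟨c₃, hc₃, h₃⟩ := h 2
    obtain ⟨c₄, -, h₄⟩ := h 3
    obtain ⟨c₅, -, h₅⟩ := h 4
    simp [funext_iff, Fin.forall_fin_succ, Matrix.mulVec, dotProduct, Fin.sum_univ_succ]
      at h₁ h₃ h₄ h₅
    obtain ⟨-, h10, h20⟩ := h₁
    obtain ⟨h01, h11, h21⟩ := h₃
    obtain ⟨h02, h12, -⟩ := h₄
    obtain ⟨-, h5, h5'⟩ := h₅
    have h22 : M 2 2 = c₃ := by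
      apply mul_right_cancel₀ ha
      linear_combination h5' - h21 - a * h5 + a * h11 + a ^ 2 * h12
    have h00 : M 0 0 = (c₃ ^ 2)⁻¹ := by
      rw [Matrix.det_fin_three, h10, h20, h01, h11, h21, h02, h12, h22] at hdet
      apply eq_inv_of_mul_eq_one_left
      linear_combination hdet
    refine ⟨c₃, hc₃, ?_⟩
    ext i j
    fin_cases i <;> fin_cases j <;> simp [h00, h10, h20, h01, h11, h21, h02, h12, h22]
  · rintro ⟨l, hl, rfl⟩ i
    refine ⟨![(l ^ 2)⁻¹, (l ^ 2)⁻¹, l, l, l, l] i, ?_, ?_⟩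
    · fin_cases i <;> simp [hl]
    · ext j
      fin_cases i <;> fin_cases j <;> simp [Matrix.mulVec_diagonal]
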